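/- For all u, v, u', v' ∈ ℂ, the multisets {u, −u, v, −v} and {u', −u', v', −v'} are equal if and only if u² + v² = u'² + v'² and u² v² = u'² v'². In other words, the 4-PolyVector encoding (u² + v², u² v²) is a complete invariant of the unordered quadruplet {u, −u, v, −v}: it is well-defined on such quadruplets and distinguishes any two distinct quadruplets. -/

import Mathlib

theorem polyVector_pair_eq (a b : ℂ) (h : a ^ 2 = b ^ 2) :
    ({a, -a} : Multiset ℂ) = {b, -b} := by
  rcases sq_eq_sq_iff_eq_or_eq_neg.mp h with h | h
  · rw [h]
  · rw [h, neg_neg, Multiset.pair_comm]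

theorem polyVector_split (a b : ℂ) :
    ({a, -a, b, -b} : Multiset ℂ) = ({a, -a} : Multiset ℂ) + {b, -b} := rfl

/-- The 4-PolyVector encoding `(u² + v², u² v²)` is a complete invariant of the
unordered quadruplet `{u, −u, v, −v}` (as a multiset): two such quadruplets are
equal iff their encodings agree. -/
theorem polyVector_encoding_complete_invariant (u v u' v' : ℂ) :
    ({u, -u, v, -v} : Multiset ℂ) = ({u', -u', v', -v'} : Multiset ℂ) ↔
      (u ^ 2 + v ^ 2 = u' ^ 2 + v' ^ 2 ∧ u ^ 2 * v ^ 2 = u' ^ 2 * v' ^ 2) := by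
  constructor
  · intro h
    have h1 := congrArg (fun s : Multiset ℂ => (s.map (fun z => z ^ 2)).sum) h
    have h2 := congrArg Multiset.prod h
    simp at h1 h2
    constructor
    · linear_combination h1 / 2
    · linear_combination h2
  · rintro ⟨h1, h2⟩
    have h3 : (u ^ 2 - u' ^ 2) * (u ^ 2 - v' ^ 2) = 0 := by
      linear_combination u ^ 2 * h1 - h2
    rw [polyVector_split, polyVector_split]
    rcases mul_eq_zero.mp h3 with h | h
    · rw [polyVector_pair_eq u u' (by linear_combination h),
        polyVector_pair_eq v v' (by linear_combination h1 - h)]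
    · rw [polyVector_pair_eq u v' (by linear_combination h),
        polyVector_pair_eq v u' (by linear_combination h1 - h), add_comm]
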